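/- Let C_a > 0, θ ≥ 0 and let g : 𝕋 → ℝ be continuous; set a := C_a + θg and assume a is even and a(x) > 0 for all x ∈ 𝕋. Let v̄ ≠ 0, T > 0, and let (ρ, j) be a classical solution of the reduced Cucker–Smale PDE with kernel a and parameter v̄ on [0,T], satisfying ∫_𝕋 ρ(x,0)dx = 1 and ∫_𝕋 j(x,0)dx = v̄. If 4θ‖g‖‖ρ(·,t)‖ ≤ C_a for all t ∈ [0,T], then for all t ∈ [0,T]: ‖ρ(·,t)‖ ≤ K, where K := ( 2(v̄²‖ρ(·,0)‖² + ‖j(·,0)‖²)/v̄² + 18‖j(·,0) − v̄ρ(·,0)‖²/v̄² )^{1/2}. -/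

import Mathlib

open Real MeasureTheory

/-- Convolution on the torus `ℝ/2πℤ`, with functions represented as `2π`-periodic
functions on `ℝ` and the integral taken over one period. -/
noncomputable def conv1 (f h : ℝ → ℝ) (x : ℝ) : ℝ :=
  ∫ y in (0:ℝ)..(2*π), f (x - y) * h y

/-- `L²(𝕋)` inner product. -/
noncomputable def ip (f h : ℝ → ℝ) : ℝ :=
  ∫ x in (0:ℝ)..(2*π), f x * h x

/-- `L²(𝕋)` norm. -/
noncomputable def nrm (f : ℝ → ℝ) : ℝ := Real.sqrt (ip f f)

/-- A classical solution of the reduced Cucker-Smale PDE with kernel `a` and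
parameter `vbar` on the time interval `I`:  smooth `2π`-periodic-in-`x` functions
`ρ, j` satisfying `∂ₜρ = −∂ₓj` and `∂ₜj = ρ(a∗j) − j(a∗ρ) − vbar²∂ₓρ` pointwise. -/
structure IsClassicalSol (a : ℝ → ℝ) (vbar : ℝ) (ρ j : ℝ → ℝ → ℝ) (I : Set ℝ) : Prop where
  periodic_rho : ∀ t ∈ I, Function.Periodic (fun x => ρ x t) (2*π)
  periodic_j : ∀ t ∈ I, Function.Periodic (fun x => j x t) (2*π)
  smooth_rho : ContDiffOn ℝ (⊤ : ℕ∞) (fun p : ℝ × ℝ => ρ p.1 p.2) (Set.univ ×ˢ I)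
  smooth_j : ContDiffOn ℝ (⊤ : ℕ∞) (fun p : ℝ × ℝ => j p.1 p.2) (Set.univ ×ˢ I)
  pde_rho : ∀ (x : ℝ), ∀ t ∈ I,
    derivWithin (fun s => ρ x s) I t = - deriv (fun y => j y t) x
  pde_j : ∀ (x : ℝ), ∀ t ∈ I,
    derivWithin (fun s => j x s) I t =
      ρ x t * conv1 a (fun y => j y t) x - j x t * conv1 a (fun y => ρ y t) x
        - vbar ^ 2 * deriv (fun y => ρ y t) x


open Set Filter Topology

theorem cs_partials (T : ℝ) (hT : 0 < T) (f : ℝ → ℝ → ℝ)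
    (hf : ContDiffOn ℝ (⊤ : ℕ∞) (fun p : ℝ × ℝ => f p.1 p.2) (univ ×ˢ Icc 0 T)) :
    ∃ ft fx : ℝ → ℝ → ℝ,
      ContinuousOn (fun p : ℝ × ℝ => ft p.1 p.2) (univ ×ˢ Icc 0 T) ∧
      ContinuousOn (fun p : ℝ × ℝ => fx p.1 p.2) (univ ×ˢ Icc 0 T) ∧
      (∀ x, ∀ t ∈ Icc 0 T, HasDerivWithinAt (fun s => f x s) (ft x t) (Icc 0 T) t) ∧
      (∀ x, ∀ t ∈ Icc 0 T, HasDerivAt (fun y => f y t) (fx x t) x) := by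
  set S : Set (ℝ × ℝ) := univ ×ˢ Icc 0 T with hS
  set F : ℝ × ℝ → ℝ := fun p => f p.1 p.2 with hF
  have hud : UniqueDiffOn ℝ S := uniqueDiffOn_univ.prod (uniqueDiffOn_Icc hT)
  have hc := hf.continuousOn_fderivWithin hud (by norm_cast)
  have hd : ∀ x, ∀ t ∈ Icc 0 T, HasFDerivWithinAt F (fderivWithin ℝ F S (x, t)) S (x, t) :=
    fun x t ht => (hf.differentiableOn (by simp) (x, t) ⟨mem_univ _, ht⟩).hasFDerivWithinAt
  refine ⟨fun x t => fderivWithin ℝ F S (x, t) (0, 1), fun x t => fderivWithin ℝ F S (x, t) (1, 0),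
    hc.clm_apply continuousOn_const, hc.clm_apply continuousOn_const, ?_, ?_⟩
  · intro x t ht
    have h1 : HasDerivWithinAt (fun s : ℝ => (x, s)) ((0 : ℝ), (1 : ℝ)) (Icc 0 T) t :=
      (hasDerivWithinAt_const _ _ _).prodMk (hasDerivWithinAt_id _ _)
    exact (hd x t ht).comp_hasDerivWithinAt t h1 (fun s hs => ⟨mem_univ _, hs⟩)
  · intro x t ht
    have h1 : HasDerivWithinAt (fun y : ℝ => (y, t)) ((1 : ℝ), (0 : ℝ)) univ x :=
      (hasDerivWithinAt_id _ _).prodMk (hasDerivWithinAt_const _ _ _)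
    have := (hd x t ht).comp_hasDerivWithinAt x h1
      (show MapsTo (fun y : ℝ => (y, t)) univ S from fun s _ => ⟨mem_univ _, ht⟩)
    exact hasDerivWithinAt_univ.1 this

theorem cs_slice_cont (T : ℝ) (f : ℝ → ℝ → ℝ)
    (hf : ContinuousOn (fun p : ℝ × ℝ => f p.1 p.2) (univ ×ˢ Icc 0 T)) (t : ℝ) (ht : t ∈ Icc 0 T) :
    Continuous (fun x => f x t) := by
  rw [← continuousOn_univ]
  exact hf.comp (f := fun x : ℝ => (x, t)) (by fun_prop) (fun x _ => ⟨mem_univ _, ht⟩)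

theorem cs_cont_int (T : ℝ) (hT : 0 < T) (F : ℝ → ℝ → ℝ)
    (hF : ContinuousOn (fun p : ℝ × ℝ => F p.1 p.2) (univ ×ˢ Icc 0 T)) :
    ContinuousOn (fun t => ∫ x in (0:ℝ)..(2*π), F x t) (Icc 0 T) := by
  have h1 : Continuous (Function.uncurry fun t x : ℝ => F x (projIcc 0 T hT.le t)) := by
    rw [← continuousOn_univ]
    refine hF.comp (f := fun p : ℝ × ℝ => (p.2, (projIcc 0 T hT.le p.1 : ℝ))) ?_ ?_
    · apply Continuous.continuousOn
      exact continuous_snd.prodMk (continuous_subtype_val.comp (continuous_projIcc.comp continuous_fst))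
    · intro p _
      exact ⟨mem_univ _, (projIcc 0 T hT.le p.1).2⟩
  have h2 := intervalIntegral.continuous_parametric_intervalIntegral_of_continuous'
    (μ := volume) h1 0 (2*π)
  refine h2.continuousOn.congr ?_
  intro t ht
  simp only [projIcc_of_mem hT.le ht]

theorem cs_diff_int (T : ℝ) (F F' : ℝ → ℝ → ℝ)
    (hF : ContinuousOn (fun p : ℝ × ℝ => F p.1 p.2) (univ ×ˢ Icc 0 T))
    (hF' : ContinuousOn (fun p : ℝ × ℝ => F' p.1 p.2) (univ ×ˢ Icc 0 T))
    (hd : ∀ x, ∀ t ∈ Ioo 0 T, HasDerivAt (fun s => F x s) (F' x t) t)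
    (t : ℝ) (ht : t ∈ Ioo 0 T) :
    HasDerivAt (fun t => ∫ x in (0:ℝ)..(2*π), F x t) (∫ x in (0:ℝ)..(2*π), F' x t) t := by
  have hK : IsCompact (Icc (0:ℝ) (2*π) ×ˢ Icc (0:ℝ) T) := isCompact_Icc.prod isCompact_Icc
  obtain ⟨C, hC⟩ := hK.exists_bound_of_continuousOn (hF'.mono (prod_mono (subset_univ _) subset_rfl))
  refine (intervalIntegral.hasDerivAt_integral_of_dominated_loc_of_deriv_le (μ := volume)
    (F := fun s x => F x s) (F' := fun s x => F' x s) (s := Ioo 0 T) (bound := fun _ => C)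
    (Ioo_mem_nhds ht.1 ht.2) ?_ ?_ ?_ ?_ ?_ ?_).2
  · filter_upwards [Ioo_mem_nhds ht.1 ht.2] with s hs
    exact (cs_slice_cont T F hF s (Ioo_subset_Icc_self hs)).aestronglyMeasurable
  · exact (cs_slice_cont T F hF t (Ioo_subset_Icc_self ht)).intervalIntegrable _ _
  · exact (cs_slice_cont T F' hF' t (Ioo_subset_Icc_self ht)).aestronglyMeasurable
  · refine Eventually.of_forall ?_
    intro x hx s hs
    rw [uIoc_of_le (by positivity)] at hx
    exact hC (x, s) ⟨Ioc_subset_Icc_self hx, Ioo_subset_Icc_self hs⟩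
  · simp
  · exact Eventually.of_forall fun x _ s hs => hd x s hs

theorem cs_ip_nonneg (f : ℝ → ℝ) : 0 ≤ ip f f :=
  intervalIntegral.integral_nonneg (by positivity) fun x _ => mul_self_nonneg _

theorem cs_nrm_sq (f : ℝ → ℝ) : nrm f ^ 2 = ip f f := Real.sq_sqrt (cs_ip_nonneg f)

theorem cs_nrm_nonneg (f : ℝ → ℝ) : 0 ≤ nrm f := Real.sqrt_nonneg _

theorem cs_cauchy (f h : ℝ → ℝ) (hf : Continuous f) (hh : Continuous h) :
    |ip f h| ≤ nrm f * nrm h := by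
  have key : ∀ s : ℝ, 0 ≤ ip f f * (s * s) + (2 * ip f h) * s + ip h h := by
    intro s
    have h0 : 0 ≤ ∫ x in (0:ℝ)..(2*π), (s * f x + h x) ^ 2 :=
      intervalIntegral.integral_nonneg (by positivity) fun x _ => sq_nonneg _
    have h1 : (∫ x in (0:ℝ)..(2*π), (s * f x + h x) ^ 2)
        = ip f f * (s * s) + (2 * ip f h) * s + ip h h := by
      unfold ip
      rw [← intervalIntegral.integral_mul_const, ← intervalIntegral.integral_const_mul,
        ← intervalIntegral.integral_mul_const, ← intervalIntegral.integral_add,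
        ← intervalIntegral.integral_add]
      · congr 1; ext x; ring
      all_goals exact Continuous.intervalIntegrable (by fun_prop) _ _
    linarith
  have hd := discrim_le_zero key
  unfold discrim at hd
  apply abs_le_of_sq_le_sq _ (mul_nonneg (cs_nrm_nonneg f) (cs_nrm_nonneg h))
  rw [mul_pow, cs_nrm_sq, cs_nrm_sq]
  nlinarith

theorem cs_nrm_abs (f : ℝ → ℝ) : nrm (fun x => |f x|) = nrm f := by
  unfold nrm ip
  simp only [abs_mul_abs_self]

theorem cs_conv_cont (f h : ℝ → ℝ) (hf : Continuous f) (hh : Continuous h) :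
    Continuous (conv1 f h) := by
  unfold conv1
  apply intervalIntegral.continuous_parametric_intervalIntegral_of_continuous'
  simp only [Function.uncurry_def]
  fun_prop

theorem cs_conv_bound (g h : ℝ → ℝ) (hg : Continuous g) (hper : Function.Periodic g (2*π))
    (hh : Continuous h) (x : ℝ) : |conv1 g h x| ≤ nrm g * nrm h := by
  have h1 := cs_cauchy (fun y => g (x - y)) h (by fun_prop) hh
  have h2 : nrm (fun y => g (x - y)) = nrm g := by
    unfold nrm ip
    congr 1
    rw [intervalIntegral.integral_comp_sub_left (fun y => g y * g y) x]
    have hp : Function.Periodic (fun y => g y * g y) (2*π) := fun y => by simp only [hper y]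
    have := hp.intervalIntegral_add_eq (x - 2*π) 0
    rw [← zero_add (2*π), ← this]
    congr 1 <;> ring
  rw [h2] at h1
  exact h1

theorem cs_tri (u r c : ℝ → ℝ) (hu : Continuous u) (hr : Continuous r) (hc : Continuous c)
    (B : ℝ) (hB : ∀ x, |c x| ≤ B) :
    |∫ x in (0:ℝ)..(2*π), u x * (r x * c x)| ≤ B * (nrm u * nrm r) := by
  have hB0 : 0 ≤ B := (abs_nonneg _).trans (hB 0)
  calc |∫ x in (0:ℝ)..(2*π), u x * (r x * c x)|
      ≤ ∫ x in (0:ℝ)..(2*π), |u x * (r x * c x)| :=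
        intervalIntegral.abs_integral_le_integral_abs (by positivity)
    _ ≤ ∫ x in (0:ℝ)..(2*π), B * (|u x| * |r x|) := by
        apply intervalIntegral.integral_mono_on (by positivity)
        · exact Continuous.intervalIntegrable (by fun_prop) _ _
        · exact Continuous.intervalIntegrable (by fun_prop) _ _
        · intro x _
          rw [abs_mul, abs_mul]
          have := mul_le_mul_of_nonneg_left (hB x) (mul_nonneg (abs_nonneg (u x)) (abs_nonneg (r x)))
          linarith
    _ = B * ip (fun x => |u x|) (fun x => |r x|) := by
        rw [intervalIntegral.integral_const_mul]; rfl
    _ ≤ B * (nrm u * nrm r) := by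
        apply mul_le_mul_of_nonneg_left _ hB0
        have := cs_cauchy (fun x => |u x|) (fun x => |r x|) (by fun_prop) (by fun_prop)
        rw [cs_nrm_abs, cs_nrm_abs] at this
        exact (le_abs_self _).trans this

theorem cs_Q_bound (g u r w : ℝ → ℝ) (hg : Continuous g) (hper : Function.Periodic g (2*π))
    (hu : Continuous u) (hr : Continuous r) (hw : Continuous w) :
    |∫ x in (0:ℝ)..(2*π), u x * (r x * conv1 g w x - w x * conv1 g r x)|
      ≤ 2 * (nrm g * nrm r * (nrm u * nrm w)) := by
  have hcw := cs_conv_cont g w hg hw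
  have hcr := cs_conv_cont g r hg hr
  have h1 := cs_tri u r _ hu hr hcw _ (cs_conv_bound g w hg hper hw)
  have h2 := cs_tri u w _ hu hw hcr _ (cs_conv_bound g r hg hper hr)
  have h3 : (∫ x in (0:ℝ)..(2*π), u x * (r x * conv1 g w x - w x * conv1 g r x))
      = (∫ x in (0:ℝ)..(2*π), u x * (r x * conv1 g w x))
        - ∫ x in (0:ℝ)..(2*π), u x * (w x * conv1 g r x) := by
    rw [← intervalIntegral.integral_sub]
    · congr 1; ext x; ring
    all_goals exact Continuous.intervalIntegrable (by fun_prop) _ _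
  rw [h3]
  refine (abs_sub _ _).trans ?_
  linarith

theorem cs_swap (a r J : ℝ → ℝ) (ha : Continuous a) (heven : ∀ x, a (-x) = a x)
    (hr : Continuous r) (hJ : Continuous J) :
    (∫ x in (0:ℝ)..(2*π), r x * conv1 a J x) = ∫ x in (0:ℝ)..(2*π), J x * conv1 a r x := by
  have hpi : (0:ℝ) ≤ 2 * π := by positivity
  unfold conv1
  simp only [← intervalIntegral.integral_const_mul]
  simp only [intervalIntegral.integral_of_le hpi]
  rw [MeasureTheory.integral_integral_swap]
  · congr 1; ext y; congr 1; ext x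
    rw [← heven (x - y), neg_sub]; ring
  · rw [Measure.prod_restrict]
    have hc : Continuous (Function.uncurry fun x y : ℝ => r x * (a (x - y) * J y)) := by
      simp only [Function.uncurry_def]; fun_prop
    exact (hc.continuousOn.integrableOn_compact (isCompact_Icc.prod isCompact_Icc)).mono_set
      (prod_mono Ioc_subset_Icc_self Ioc_subset_Icc_self)

theorem cs_int_deriv (f f' : ℝ → ℝ) (hf : ∀ x, HasDerivAt f (f' x) x) (hc : Continuous f')
    (hper : Function.Periodic f (2*π)) : (∫ x in (0:ℝ)..(2*π), f' x) = 0 := by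
  rw [intervalIntegral.integral_eq_sub_of_hasDerivAt (fun x _ => hf x) (hc.intervalIntegrable _ _)]
  have := hper 0
  rw [zero_add] at this
  rw [this, sub_self]

theorem cs_anti (T : ℝ) (f f' : ℝ → ℝ) (hc : ContinuousOn f (Icc 0 T))
    (hd : ∀ t ∈ Ioo 0 T, HasDerivAt f (f' t) t) (hn : ∀ t ∈ Ioo 0 T, f' t ≤ 0) :
    ∀ t ∈ Icc 0 T, f t ≤ f 0 := by
  intro t ht
  have h := antitoneOn_of_deriv_nonpos (convex_Icc 0 T) hc
    (by rw [interior_Icc]; exact fun s hs => (hd s hs).differentiableAt.differentiableWithinAt)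
    (by rw [interior_Icc]; intro s hs; rw [(hd s hs).deriv]; exact hn s hs)
  exact h ⟨le_rfl, ht.1.trans ht.2⟩ ht ht.1

theorem cs_const (T : ℝ) (f f' : ℝ → ℝ) (hc : ContinuousOn f (Icc 0 T))
    (hd : ∀ t ∈ Ioo 0 T, HasDerivAt f (f' t) t) (hn : ∀ t ∈ Ioo 0 T, f' t = 0) :
    ∀ t ∈ Icc 0 T, f t = f 0 := by
  intro t ht
  have h1 := cs_anti T f f' hc hd (fun s hs => (hn s hs).le) t ht
  have h2 := cs_anti T (fun s => - f s) (fun s => - f' s) hc.neg (fun s hs => (hd s hs).neg)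
    (fun s hs => by simp [hn s hs]) t ht
  linarith

/-- Pointwise rewriting of the alignment term. -/
theorem cs_align (Ca θ v : ℝ) (g r J : ℝ → ℝ) (hg : Continuous g) (hr : Continuous r)
    (hJ : Continuous J) (hmr : (∫ x in (0:ℝ)..(2*π), r x) = 1)
    (hmJ : (∫ x in (0:ℝ)..(2*π), J x) = v) (x : ℝ) :
    r x * conv1 (fun x => Ca + θ * g x) J x - J x * conv1 (fun x => Ca + θ * g x) r x
      = - Ca * (J x - v * r x) + θ * (r x * conv1 g (fun y => J y - v * r y) x
          - (J x - v * r x) * conv1 g r x) := by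
  have h1 : ∀ f : ℝ → ℝ, Continuous f → conv1 (fun x => Ca + θ * g x) f x
      = Ca * (∫ y in (0:ℝ)..(2*π), f y) + θ * conv1 g f x := by
    intro f hf
    unfold conv1
    rw [← intervalIntegral.integral_const_mul, ← intervalIntegral.integral_const_mul,
      ← intervalIntegral.integral_add]
    · congr 1; ext y; ring
    all_goals exact Continuous.intervalIntegrable (by fun_prop) _ _
  have h2 : conv1 g (fun y => J y - v * r y) x = conv1 g J x - v * conv1 g r x := by
    unfold conv1
    rw [← intervalIntegral.integral_const_mul, ← intervalIntegral.integral_sub]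
    · congr 1; ext y; ring
    all_goals exact Continuous.intervalIntegrable (by fun_prop) _ _
  rw [h1 J hJ, h1 r hr, h2, hmr, hmJ]
  ring

theorem cs_W_deriv (Ca θ v : ℝ) (hCa : 0 < Ca) (hθ : 0 ≤ θ) (g r J rx jx : ℝ → ℝ)
    (hg : Continuous g) (hper : Function.Periodic g (2*π)) (hr : Continuous r) (hJ : Continuous J)
    (hrx : Continuous rx) (hjx : Continuous jx)
    (hdr : ∀ x, HasDerivAt r (rx x) x) (hdJ : ∀ x, HasDerivAt J (jx x) x)
    (hpr : Function.Periodic r (2*π)) (hpJ : Function.Periodic J (2*π))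
    (hsm : 4 * θ * nrm g * nrm r ≤ Ca) :
    (∫ x in (0:ℝ)..(2*π), 2 * (J x - v * r x) *
      ((- Ca * (J x - v * r x) + θ * (r x * conv1 g (fun y => J y - v * r y) x
          - (J x - v * r x) * conv1 g r x)) - v ^ 2 * rx x - v * (- jx x)))
      ≤ - Ca * nrm (fun x => J x - v * r x) ^ 2 := by
  set w : ℝ → ℝ := fun x => J x - v * r x with hw
  have hwc : Continuous w := by fun_prop
  have hcw := cs_conv_cont g w hg hwc
  have hcr := cs_conv_cont g r hg hr
  have hQ := cs_Q_bound g w r w hg hper hwc hr hwc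
  have h0 : (∫ x in (0:ℝ)..(2*π), v * (2 * w x * (jx x - v * rx x))) = 0 := by
    refine cs_int_deriv (fun x => v * (w x ^ 2)) _ ?_ (by fun_prop) ?_
    · intro x
      have := (((hdJ x).sub ((hdr x).const_mul v)).pow 2).const_mul v
      refine this.congr_deriv ?_
      simp [hw]
    · intro x
      simp only [hw, hpr x, hpJ x]
  have hsplit : (∫ x in (0:ℝ)..(2*π), 2 * (J x - v * r x) *
      ((- Ca * (J x - v * r x) + θ * (r x * conv1 g w x
          - (J x - v * r x) * conv1 g r x)) - v ^ 2 * rx x - v * (- jx x)))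
      = (-2 * Ca) * ip w w + (2 * θ) * (∫ x in (0:ℝ)..(2*π),
          w x * (r x * conv1 g w x - w x * conv1 g r x))
        + ∫ x in (0:ℝ)..(2*π), v * (2 * w x * (jx x - v * rx x)) := by
    unfold ip
    rw [← intervalIntegral.integral_const_mul, ← intervalIntegral.integral_const_mul,
      ← intervalIntegral.integral_add, ← intervalIntegral.integral_add]
    · congr 1; ext x; simp only [hw]; ring
    all_goals exact Continuous.intervalIntegrable (by fun_prop) _ _
  rw [hsplit, h0, ← cs_nrm_sq]
  have hQ' := mul_le_mul_of_nonneg_left ((le_abs_self _).trans hQ) (mul_nonneg zero_le_two hθ)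
  have hs' := mul_le_mul_of_nonneg_right hsm (sq_nonneg (nrm w))
  nlinarith

theorem cs_E_deriv (Ca θ v : ℝ) (hCa : 0 < Ca) (hθ : 0 ≤ θ) (g r J rx jx : ℝ → ℝ)
    (hg : Continuous g) (hper : Function.Periodic g (2*π)) (hr : Continuous r) (hJ : Continuous J)
    (hrx : Continuous rx) (hjx : Continuous jx)
    (hdr : ∀ x, HasDerivAt r (rx x) x) (hdJ : ∀ x, HasDerivAt J (jx x) x)
    (hpr : Function.Periodic r (2*π)) (hpJ : Function.Periodic J (2*π))
    (hsm : 4 * θ * nrm g * nrm r ≤ Ca) :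
    (∫ x in (0:ℝ)..(2*π), (v ^ 2 * (2 * r x * (- jx x)) + 2 * J x *
      ((- Ca * (J x - v * r x) + θ * (r x * conv1 g (fun y => J y - v * r y) x
          - (J x - v * r x) * conv1 g r x)) - v ^ 2 * rx x)))
      ≤ 3 * Ca * (nrm J * nrm (fun x => J x - v * r x)) := by
  set w : ℝ → ℝ := fun x => J x - v * r x with hw
  have hwc : Continuous w := by fun_prop
  have hcw := cs_conv_cont g w hg hwc
  have hcr := cs_conv_cont g r hg hr
  have hQ := cs_Q_bound g J r w hg hper hJ hr hwc
  have hC := cs_cauchy J w hJ hwc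
  have h0 : (∫ x in (0:ℝ)..(2*π), (-2 * v ^ 2) * (rx x * J x + r x * jx x)) = 0 := by
    refine cs_int_deriv (fun x => (-2 * v ^ 2) * (r x * J x)) _ ?_ (by fun_prop) ?_
    · intro x
      exact ((hdr x).mul (hdJ x)).const_mul _
    · intro x
      simp only [hpr x, hpJ x]
  have hsplit : (∫ x in (0:ℝ)..(2*π), (v ^ 2 * (2 * r x * (- jx x)) + 2 * J x *
      ((- Ca * (J x - v * r x) + θ * (r x * conv1 g w x
          - (J x - v * r x) * conv1 g r x)) - v ^ 2 * rx x)))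
      = (-2 * Ca) * ip J w + (2 * θ) * (∫ x in (0:ℝ)..(2*π),
          J x * (r x * conv1 g w x - w x * conv1 g r x))
        + ∫ x in (0:ℝ)..(2*π), (-2 * v ^ 2) * (rx x * J x + r x * jx x) := by
    unfold ip
    rw [← intervalIntegral.integral_const_mul, ← intervalIntegral.integral_const_mul,
      ← intervalIntegral.integral_add, ← intervalIntegral.integral_add]
    · congr 1; ext x; simp only [hw]; ring
    all_goals exact Continuous.intervalIntegrable (by fun_prop) _ _
  rw [hsplit, h0]
  have hQ' := mul_le_mul_of_nonneg_left ((le_abs_self _).trans hQ) (mul_nonneg zero_le_two hθ)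
  have hs' := mul_le_mul_of_nonneg_right hsm (mul_nonneg (cs_nrm_nonneg J) (cs_nrm_nonneg w))
  have hC' := mul_le_mul_of_nonneg_left ((neg_le_abs _).trans hC) (mul_nonneg zero_le_two hCa.le)
  nlinarith

/-- The ODE comparison argument. -/
theorem cs_ode (T C : ℝ) (hC : 0 < C) (E W E' W' : ℝ → ℝ)
    (hEc : ContinuousOn E (Icc 0 T)) (hWc : ContinuousOn W (Icc 0 T))
    (hEd : ∀ t ∈ Ioo 0 T, HasDerivAt E (E' t) t) (hWd : ∀ t ∈ Ioo 0 T, HasDerivAt W (W' t) t)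
    (hEp : ∀ t ∈ Icc 0 T, 0 < E t) (hWp : ∀ t ∈ Icc 0 T, 0 ≤ W t)
    (hW' : ∀ t ∈ Ioo 0 T, W' t ≤ - C * W t)
    (hE' : ∀ t ∈ Ioo 0 T, E' t ≤ 3 * C * (√(E t) * √(W t))) :
    ∀ t ∈ Icc 0 T, E t ≤ 2 * E 0 + 18 * W 0 := by
  have hexp : ∀ k t : ℝ, HasDerivAt (fun s => Real.exp (k * s)) (Real.exp (k * t) * k) t := by
    intro k t
    simpa using ((hasDerivAt_id t).const_mul k).exp
  have h1 : ∀ t ∈ Icc 0 T, W t * Real.exp (C * t) ≤ W 0 := by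
    intro t ht
    have := cs_anti T (fun s => W s * Real.exp (C * s)) _ (hWc.mul (by fun_prop))
      (fun s hs => (hWd s hs).mul (hexp C s)) (fun s hs => by
        have := mul_le_mul_of_nonneg_right (hW' s hs) (Real.exp_pos (C * s)).le
        linarith) t ht
    simpa using this
  have h2 : ∀ t ∈ Icc 0 T, √(W t) ≤ √(W 0) * Real.exp (-(C/2) * t) := by
    intro t ht
    apply Real.sqrt_le_iff.2
    refine ⟨by positivity, ?_⟩
    have h0 : 0 ≤ W 0 := hWp 0 ⟨le_rfl, ht.1.trans ht.2⟩
    rw [mul_pow, Real.sq_sqrt h0, ← Real.exp_nat_mul]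
    have h3 := mul_le_mul_of_nonneg_right (h1 t ht) (Real.exp_pos (-(C * t))).le
    rw [mul_assoc, ← Real.exp_add, add_neg_cancel, Real.exp_zero, mul_one] at h3
    have h5 : ((2:ℕ):ℝ) * (-(C/2) * t) = -(C * t) := by push_cast; ring
    rw [h5]
    exact h3
  intro t ht
  have h0T : (0:ℝ) ∈ Icc 0 T := ⟨le_rfl, ht.1.trans ht.2⟩
  have h4 := cs_anti T (fun s => √(E s) + 3 * √(W 0) * Real.exp (-(C/2) * s)) _
    (hEc.sqrt.add (by fun_prop))
    (fun s hs => ((hEd s hs).sqrt (hEp s (Ioo_subset_Icc_self hs)).ne').add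
      ((hexp (-(C/2)) s).const_mul (3 * √(W 0)))) (fun s hs => by
        have hs' := Ioo_subset_Icc_self hs
        have hsp : 0 < √(E s) := Real.sqrt_pos.2 (hEp s hs')
        have h5 : E' s / (2 * √(E s)) ≤ 3 / 2 * C * √(W s) := by
          rw [div_le_iff₀ (by positivity)]
          have := hE' s hs
          nlinarith
        have h6 := mul_le_mul_of_nonneg_left (h2 s hs') (show 0 ≤ 3/2 * C by positivity)
        nlinarith) t ht
  simp only [mul_zero, Real.exp_zero, mul_one] at h4
  have h7 : √(E t) ≤ √(E 0) + 3 * √(W 0) := by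
    have : 0 ≤ 3 * √(W 0) * Real.exp (-(C/2) * t) := by positivity
    linarith
  have h8 := Real.sq_sqrt (hEp t ht).le
  have h9 := Real.sq_sqrt (hEp 0 h0T).le
  have h10 := Real.sq_sqrt (hWp 0 h0T)
  have h11 : √(E t) ^ 2 ≤ (√(E 0) + 3 * √(W 0)) ^ 2 := pow_le_pow_left₀ (Real.sqrt_nonneg _) h7 2
  nlinarith [sq_nonneg (√(E 0) - 3 * √(W 0))]

/-- Step III of Proposition `local_result`: energy estimate `‖ρ(·,t)‖ ≤ K` as long as
`4θ‖g‖‖ρ(·,t)‖ ≤ C_a` on `[0,T]`. -/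
theorem stmt4 (Ca θ : ℝ) (hCa : 0 < Ca) (hθ : 0 ≤ θ)
    (g : ℝ → ℝ) (hg_cont : Continuous g) (hg_per : Function.Periodic g (2*π))
    (a : ℝ → ℝ) (ha : a = fun x => Ca + θ * g x)
    (ha_even : ∀ x, a (-x) = a x) (ha_pos : ∀ x, 0 < a x)
    (vbar : ℝ) (hvbar : vbar ≠ 0) (T : ℝ) (hT : 0 < T)
    (ρ j : ℝ → ℝ → ℝ) (hsol : IsClassicalSol a vbar ρ j (Set.Icc 0 T))
    (hmass_rho : (∫ x in (0:ℝ)..(2*π), ρ x 0) = 1)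
    (hmass_j : (∫ x in (0:ℝ)..(2*π), j x 0) = vbar)
    (hsmall : ∀ t ∈ Set.Icc (0:ℝ) T, 4 * θ * nrm g * nrm (fun x => ρ x t) ≤ Ca)
    (K : ℝ)
    (hK : K = Real.sqrt
      (2 * (vbar ^ 2 * nrm (fun x => ρ x 0) ^ 2 + nrm (fun x => j x 0) ^ 2) / vbar ^ 2
        + 18 * nrm (fun x => j x 0 - vbar * ρ x 0) ^ 2 / vbar ^ 2)) :
    ∀ t ∈ Set.Icc (0:ℝ) T, nrm (fun x => ρ x t) ≤ K := by
  obtain ⟨rt, rx, hrtc, hrxc, hrt, hrx⟩ := cs_partials T hT ρ hsol.smooth_rho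
  obtain ⟨jt, jx, hjtc, hjxc, hjt, hjx⟩ := cs_partials T hT j hsol.smooth_j
  have hrc := hsol.smooth_rho.continuousOn
  have hjc := hsol.smooth_j.continuousOn
  have hgc : Continuous a := by rw [ha]; fun_prop
  have e1 : ∀ x, ∀ t ∈ Icc 0 T, rt x t = - jx x t := by
    intro x t ht
    rw [← (hrt x t ht).derivWithin (uniqueDiffOn_Icc hT t ht), ← (hjx x t ht).deriv]
    exact hsol.pde_rho x t ht
  have e2 : ∀ x, ∀ t ∈ Icc 0 T, jt x t = ρ x t * conv1 a (fun y => j y t) x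
      - j x t * conv1 a (fun y => ρ y t) x - vbar ^ 2 * rx x t := by
    intro x t ht
    rw [← (hjt x t ht).derivWithin (uniqueDiffOn_Icc hT t ht), ← (hrx x t ht).deriv]
    exact hsol.pde_j x t ht
  have hrt' : ∀ x, ∀ t ∈ Ioo 0 T, HasDerivAt (fun s => ρ x s) (rt x t) t := fun x t ht =>
    (hrt x t (Ioo_subset_Icc_self ht)).hasDerivAt (Icc_mem_nhds ht.1 ht.2)
  have hjt' : ∀ x, ∀ t ∈ Ioo 0 T, HasDerivAt (fun s => j x s) (jt x t) t := fun x t ht =>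
    (hjt x t (Ioo_subset_Icc_self ht)).hasDerivAt (Icc_mem_nhds ht.1 ht.2)
  have sr := cs_slice_cont T ρ hrc
  have sj := cs_slice_cont T j hjc
  have srx := cs_slice_cont T rx hrxc
  have sjx := cs_slice_cont T jx hjxc
  -- conservation of mass
  have hm : ∀ t ∈ Icc 0 T, (∫ x in (0:ℝ)..(2*π), ρ x t) = 1 := by
    intro t ht
    rw [← hmass_rho]
    refine cs_const T (fun t => ∫ x in (0:ℝ)..(2*π), ρ x t) _ (cs_cont_int T hT ρ hrc)
      (cs_diff_int T ρ rt hrc hrtc hrt') ?_ t ht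
    intro s hs
    have hs' := Ioo_subset_Icc_self hs
    simp only [e1 _ s hs', intervalIntegral.integral_neg]
    rw [cs_int_deriv _ _ (fun x => hjx x s hs') (sjx s hs') (hsol.periodic_j s hs'), neg_zero]
  -- conservation of momentum
  have hmj : ∀ t ∈ Icc 0 T, (∫ x in (0:ℝ)..(2*π), j x t) = vbar := by
    intro t ht
    rw [← hmass_j]
    refine cs_const T (fun t => ∫ x in (0:ℝ)..(2*π), j x t) _ (cs_cont_int T hT j hjc)
      (cs_diff_int T j jt hjc hjtc hjt') ?_ t ht
    intro s hs
    have hs' := Ioo_subset_Icc_self hs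
    have c1 := cs_conv_cont a _ hgc (sj s hs')
    have c2 := cs_conv_cont a _ hgc (sr s hs')
    have c3 := sr s hs'
    have c4 := sj s hs'
    have c5 := srx s hs'
    simp only [e2 _ s hs']
    rw [intervalIntegral.integral_sub, intervalIntegral.integral_sub,
      intervalIntegral.integral_const_mul,
      cs_int_deriv _ _ (fun x => hrx x s hs') (srx s hs') (hsol.periodic_rho s hs'),
      cs_swap a (fun x => ρ x s) (fun x => j x s) hgc ha_even c3 c4]
    · ring
    all_goals exact Continuous.intervalIntegrable (by fun_prop) _ _
  have e3 : ∀ x, ∀ t ∈ Icc 0 T, jt x t = (- Ca * (j x t - vbar * ρ x t)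
      + θ * (ρ x t * conv1 g (fun y => j y t - vbar * ρ y t) x
          - (j x t - vbar * ρ x t) * conv1 g (fun y => ρ y t) x)) - vbar ^ 2 * rx x t := by
    intro x t ht
    rw [e2 x t ht, ha, cs_align Ca θ vbar g _ _ hg_cont (sr t ht) (sj t ht) (hm t ht) (hmj t ht) x]
  have hipE : ∀ t ∈ Icc 0 T, (∫ x in (0:ℝ)..(2*π), (vbar ^ 2 * ρ x t ^ 2 + j x t ^ 2))
      = vbar ^ 2 * nrm (fun x => ρ x t) ^ 2 + nrm (fun x => j x t) ^ 2 := by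
    intro t ht
    have c3 := sr t ht
    have c4 := sj t ht
    rw [cs_nrm_sq, cs_nrm_sq, intervalIntegral.integral_add, intervalIntegral.integral_const_mul]
    · simp only [ip, pow_two]
    all_goals exact Continuous.intervalIntegrable (by fun_prop) _ _
  have hipW : ∀ t, (∫ x in (0:ℝ)..(2*π), (j x t - vbar * ρ x t) ^ 2)
      = nrm (fun x => j x t - vbar * ρ x t) ^ 2 := by
    intro t
    rw [cs_nrm_sq]
    simp only [ip, pow_two]
  have hv2 : 0 < vbar ^ 2 := by positivity
  have hrpos : ∀ t ∈ Icc 0 T, 0 < nrm (fun x => ρ x t) := by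
    intro t ht
    have h := cs_cauchy (fun x => ρ x t) (fun _ => 1) (sr t ht) continuous_const
    simp only [ip, mul_one] at h
    rw [hm t ht, abs_one] at h
    rcases (cs_nrm_nonneg (fun x => ρ x t)).lt_or_eq with h' | h'
    · exact h'
    · rw [← h', zero_mul] at h; linarith
  have main := cs_ode T Ca hCa
    (fun t => ∫ x in (0:ℝ)..(2*π), (vbar ^ 2 * ρ x t ^ 2 + j x t ^ 2))
    (fun t => ∫ x in (0:ℝ)..(2*π), (j x t - vbar * ρ x t) ^ 2)
    (fun t => ∫ x in (0:ℝ)..(2*π), (vbar ^ 2 * (2 * ρ x t * rt x t) + 2 * j x t * jt x t))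
    (fun t => ∫ x in (0:ℝ)..(2*π), 2 * (j x t - vbar * ρ x t) * (jt x t - vbar * rt x t))
    (cs_cont_int T hT (fun x t => vbar ^ 2 * ρ x t ^ 2 + j x t ^ 2) (by fun_prop))
    (cs_cont_int T hT (fun x t => (j x t - vbar * ρ x t) ^ 2) (by fun_prop))
    (cs_diff_int T (fun x t => vbar ^ 2 * ρ x t ^ 2 + j x t ^ 2)
      (fun x t => vbar ^ 2 * (2 * ρ x t * rt x t) + 2 * j x t * jt x t)
      (by fun_prop) (by fun_prop) (fun x t ht => by
        refine ((((hrt' x t ht).pow 2).const_mul (vbar ^ 2)).add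
          ((hjt' x t ht).pow 2)).congr_deriv ?_
        simp))
    (cs_diff_int T (fun x t => (j x t - vbar * ρ x t) ^ 2)
      (fun x t => 2 * (j x t - vbar * ρ x t) * (jt x t - vbar * rt x t))
      (by fun_prop) (by fun_prop) (fun x t ht => by
        refine (((hjt' x t ht).sub ((hrt' x t ht).const_mul vbar)).pow 2).congr_deriv ?_
        simp))
    (fun t ht => by
      simp only [hipE t ht]
      have := hrpos t ht
      positivity)
    (fun t ht => by simp only [hipW]; positivity)
    (fun t ht => by
      have ht' := Ioo_subset_Icc_self ht
      simp only [hipW, e3 _ t ht', e1 _ t ht']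
      exact cs_W_deriv Ca θ vbar hCa hθ g _ _ (fun x => rx x t) (fun x => jx x t) hg_cont hg_per
        (sr t ht') (sj t ht') (srx t ht') (sjx t ht') (fun x => hrx x t ht') (fun x => hjx x t ht')
        (hsol.periodic_rho t ht') (hsol.periodic_j t ht') (hsmall t ht'))
    (fun t ht => by
      have ht' := Ioo_subset_Icc_self ht
      simp only [hipW, hipE t ht', e3 _ t ht', e1 _ t ht']
      refine (cs_E_deriv Ca θ vbar hCa hθ g _ _ (fun x => rx x t) (fun x => jx x t) hg_cont hg_per
        (sr t ht') (sj t ht') (srx t ht') (sjx t ht') (fun x => hrx x t ht') (fun x => hjx x t ht')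
        (hsol.periodic_rho t ht') (hsol.periodic_j t ht') (hsmall t ht')).trans ?_
      rw [Real.sqrt_sq (cs_nrm_nonneg _)]
      have h1 : nrm (fun x => j x t)
          ≤ √(vbar ^ 2 * nrm (fun x => ρ x t) ^ 2 + nrm (fun x => j x t) ^ 2) := by
        apply Real.le_sqrt_of_sq_le
        have : 0 ≤ vbar ^ 2 * nrm (fun x => ρ x t) ^ 2 := by positivity
        linarith
      have h2 := mul_le_mul_of_nonneg_right h1 (cs_nrm_nonneg (fun x => j x t - vbar * ρ x t))
      exact mul_le_mul_of_nonneg_left h2 (by positivity))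
  intro t ht
  have hfin := main t ht
  simp only [hipW, hipE t ht, hipE 0 ⟨le_rfl, hT.le⟩] at hfin
  rw [hK]
  apply Real.le_sqrt_of_sq_le
  rw [← add_div, le_div_iff₀ hv2]
  nlinarith [sq_nonneg (nrm (fun x => j x t))]
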